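/- Let n ≥ 1, R > 0, 1 < p < ∞, b > 1, a < n and 0 < c ≤ (n-a)/(b-1). For a real-valued f ∈ C_0^1(B(0,R)\{0}) set u(x) = (p/((b-1)c)) · |x| (1-(|x|/R)^c) · (−𝓡f(x)). Then the following identity holds: ((b-1)c/p)^p · ∫_{B(0,R)} |f(x)|^p / (|x|^a (1-(|x|/R)^c)^b) dx = ∫_{B(0,R)} |𝓡f(x)|^p / (|x|^{a-p} (1-(|x|/R)^c)^{b-p}) dx − p · ((b-1)c/p)^p · ∫_{B(0,R)} I_p(f,u)(x) · |f(x)-u(x)|² / (|x|^a (1-(|x|/R)^c)^b) dx − (n-a-(b-1)c) · ((b-1)c/p)^{p-1} · ∫_{B(0,R)} |f(x)|^p / (|x|^a (1-(|x|/R)^c)^{b-1}) dx. -/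

import Mathlib

open MeasureTheory Metric

/-- The radial derivative `𝓡f(x) = Df(x)[x/|x|]` of a real-valued function on `ℝⁿ`. -/
noncomputable def radDerivR {n : ℕ} (f : EuclideanSpace ℝ (Fin n) → ℝ)
    (x : EuclideanSpace ℝ (Fin n)) : ℝ :=
  fderiv ℝ f x (‖x‖⁻¹ • x)

/-- `I_p(v, u) = (p-1) ∫₀¹ |ξ v + (1-ξ) u|^{p-2} ξ dξ`. -/
noncomputable def Ip (p v u : ℝ) : ℝ :=
  (p - 1) * ∫ ξ in (0:ℝ)..1, |ξ * v + (1 - ξ) * u| ^ (p - 2) * ξ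

theorem continuous_abs_rpow_sub_two_mul {p : ℝ} (hp : 1 < p) :
    Continuous fun x : ℝ ↦ |x| ^ (p - 2) * x := by
  have h := (contDiff_norm_rpow (E := ℝ) hp).continuous_deriv le_rfl
  have h' : deriv (fun x : ℝ ↦ ‖x‖ ^ p) = fun x ↦ p * (|x| ^ (p - 2) * x) := by
    ext x
    rw [(hasDerivAt_norm_rpow x hp).deriv, Real.norm_eq_abs, mul_assoc]
  rw [h'] at h
  refine (h.const_mul p⁻¹).congr fun x ↦ ?_
  have : p ≠ 0 := by linarith
  field_simp

theorem intervalIntegrable_abs_rpow {r : ℝ} (hr : -1 < r) (a b : ℝ) :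
    IntervalIntegrable (fun x : ℝ ↦ |x| ^ r) volume a b := by
  have h := (intervalIntegral.intervalIntegrable_cpow' (a := a) (b := b) (r := (r : ℂ))
    (by simpa using hr)).norm
  simpa [Complex.norm_cpow_real] using h

theorem hasDerivAt_abs_rpow_sub_two_mul {p x : ℝ} (hx : x ≠ 0) :
    HasDerivAt (fun x : ℝ ↦ |x| ^ (p - 2) * x) ((p - 1) * |x| ^ (p - 2)) x := by
  have h := ((hasDerivAt_abs hx).rpow_const (p := p - 2) (Or.inl (abs_ne_zero.2 hx))).mul
    (hasDerivAt_id x)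
  refine h.congr_deriv ?_
  have h1 : ((SignType.sign x : SignType) : ℝ) * x = |x| := sign_mul_self x
  have h2 : |x| ^ (p - 2 - 1) * |x| = |x| ^ (p - 2) := by
    rw [Real.rpow_sub_one (abs_ne_zero.2 hx)]
    field_simp
  simp only [id]
  linear_combination (p - 2) * |x| ^ (p - 2 - 1) * h1 + (p - 2) * h2

theorem integral_abs_rpow_sub_two_mul_sub {p : ℝ} (hp : 1 < p) (v u : ℝ) :
    p * (p - 1) * ∫ w in u..v, |w| ^ (p - 2) * (w - u) =
      |u| ^ p + (p - 1) * |v| ^ p - p * (|v| ^ (p - 2) * v) * u := by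
  have hcont := continuous_abs_rpow_sub_two_mul hp
  have hcont' : Continuous fun w : ℝ ↦ |w| ^ p :=
    continuous_abs.rpow_const fun _ ↦ Or.inr (by linarith)
  have key := integral_eq_of_hasDerivAt_off_countable
    (fun w ↦ p * (|w| ^ (p - 2) * w * (w - u)) - |w| ^ p)
    (fun w ↦ p * (p - 1) * (|w| ^ (p - 2) * (w - u))) (a := u) (b := v) (s := {0})
    (Set.countable_singleton 0) (by fun_prop) (fun w hw ↦ by
      have hw0 : w ≠ 0 := fun h ↦ hw.2 (by simpa using h)
      refine ((((hasDerivAt_abs_rpow_sub_two_mul (p := p) hw0).mul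
        ((hasDerivAt_id w).sub_const u)).const_mul p).sub (hasDerivAt_abs_rpow w hp)).congr_deriv ?_
      simp only [id]
      ring)
    (((intervalIntegrable_abs_rpow (by linarith) u v).mul_continuousOn
      (by fun_prop)).const_mul _)
  rw [intervalIntegral.integral_const_mul] at key
  have hv : |v| ^ (p - 2) * v * v = |v| ^ p := by
    by_cases h0 : v = 0
    · simp [h0, Real.zero_rpow (by linarith : p ≠ 0)]
    · rw [mul_assoc, ← abs_mul_abs_self, ← mul_assoc, ← Real.rpow_add_one (abs_ne_zero.2 h0),
        ← Real.rpow_add_one (abs_ne_zero.2 h0)]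
      ring_nf
  rw [key]
  linear_combination p * hv

theorem Ip_mul_abs_sub_sq {p : ℝ} (hp : 1 < p) (v u : ℝ) :
    p * (Ip p v u * |v - u| ^ 2) =
      |u| ^ p + (p - 1) * |v| ^ p - p * (|v| ^ (p - 2) * v) * u := by
  rw [← integral_abs_rpow_sub_two_mul_sub hp, Ip, sq_abs]
  have h := intervalIntegral.smul_integral_comp_add_mul (a := 0) (b := 1)
    (fun w ↦ |w| ^ (p - 2) * (w - u)) (v - u) u
  have h' : (fun ξ : ℝ ↦ |u + (v - u) * ξ| ^ (p - 2) * (u + (v - u) * ξ - u)) =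
      fun ξ ↦ (v - u) * (|ξ * v + (1 - ξ) * u| ^ (p - 2) * ξ) := by
    ext ξ
    rw [show u + (v - u) * ξ = ξ * v + (1 - ξ) * u by ring]
    ring
  simp only [h', intervalIntegral.integral_const_mul, smul_eq_mul] at h
  rw [show u + (v - u) * 0 = u by ring, show u + (v - u) * 1 = v by ring] at h
  rw [← h]
  ring

theorem integrable_of_continuousAt_of_isCompact {E : Type*} [TopologicalSpace E] [T2Space E]
    [MeasurableSpace E] [BorelSpace E] {μ : Measure E} [IsFiniteMeasureOnCompacts μ]
    {g : E → ℝ} {S : Set E} (hS : IsCompact S) (hg : ∀ x ∈ S, ContinuousAt g x)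
    (h0 : ∀ x ∉ S, g x = 0) : Integrable g μ := by
  have hc : ContinuousOn g S := fun x hx ↦ (hg x hx).continuousWithinAt
  exact (hc.integrableOn_compact hS).integrable_of_forall_notMem_eq_zero h0

theorem integral_fderiv_apply_self {n : ℕ} {H : EuclideanSpace ℝ (Fin n) → ℝ}
    (hH : ContDiff ℝ 1 H) (hs : HasCompactSupport H) :
    ∫ x, fderiv ℝ H x x = -(n * ∫ x, H x) := by
  have hsum (x : EuclideanSpace ℝ (Fin n)) :
      fderiv ℝ H x x = ∑ i, x i * fderiv ℝ H x (EuclideanSpace.single i 1) := by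
    conv_lhs =>
      enter [2]
      rw [← (EuclideanSpace.basisFun (Fin n) ℝ).sum_repr x]
    simp
  have hfd : Continuous fun x ↦ fderiv ℝ H x := hH.continuous_fderiv one_ne_zero
  have hint (i : Fin n) :
      Integrable fun x ↦ x i * fderiv ℝ H x (EuclideanSpace.single i 1) := by
    refine Continuous.integrable_of_hasCompactSupport (by fun_prop) ?_
    exact (hs.fderiv_apply (𝕜 := ℝ) _).mul_left
  simp_rw [hsum]
  rw [integral_finsetSum _ fun i _ ↦ hint i]
  have hcoord (i : Fin n) (x : EuclideanSpace ℝ (Fin n)) :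
      fderiv ℝ (fun y : EuclideanSpace ℝ (Fin n) ↦ y i) x (EuclideanSpace.single i 1) = 1 := by
    have : HasFDerivAt (fun y : EuclideanSpace ℝ (Fin n) ↦ y i)
        (EuclideanSpace.proj i : EuclideanSpace ℝ (Fin n) →L[ℝ] ℝ) x :=
      (EuclideanSpace.proj i : EuclideanSpace ℝ (Fin n) →L[ℝ] ℝ).hasFDerivAt
    rw [this.fderiv]
    simp
  have hi (i : Fin n) :
      ∫ x, x i * fderiv ℝ H x (EuclideanSpace.single i 1) = -∫ x, H x := by
    rw [integral_mul_fderiv_eq_neg_fderiv_mul_of_integrable]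
    · simp [hcoord]
    · simpa [hcoord] using hH.continuous.integrable_of_hasCompactSupport hs
    · exact hint i
    · exact (show Continuous fun x : EuclideanSpace ℝ (Fin n) ↦ x i * H x from
        (by fun_prop : Continuous fun x : EuclideanSpace ℝ (Fin n) ↦ x i).mul
          hH.continuous).integrable_of_hasCompactSupport hs.mul_left
    · exact fun x _ ↦ by fun_prop
    · exact fun x _ ↦ (hH.differentiable one_ne_zero) x
  simp [hi]

theorem hasDerivAt_hardyWeight {r R a b c : ℝ} (hr : 0 < r) (hR : 0 < R)
    (hq : 0 < 1 - (r / R) ^ c) :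
    HasDerivAt (fun t : ℝ ↦ (t * r) ^ a * (1 - (t * r / R) ^ c) ^ (b - 1))
      (r ^ a * (1 - (r / R) ^ c) ^ (b - 1) *
        (a + (b - 1) * c - (b - 1) * c / (1 - (r / R) ^ c))) 1 := by
  have h1 : HasDerivAt (fun t : ℝ ↦ t * r) r 1 := by
    simpa using (hasDerivAt_id (1 : ℝ)).mul_const r
  have hrR : 0 < r / R := div_pos hr hR
  have h2 := h1.rpow_const (p := a) (Or.inl (by simpa using hr.ne'))
  have h3 := (h1.div_const R).rpow_const (p := c) (Or.inl (by simpa using hrR.ne'))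
  have h4 := (h3.const_sub 1).rpow_const (p := b - 1) (Or.inl (by simpa using hq.ne'))
  refine (h2.mul h4).congr_deriv ?_
  simp only [one_mul]
  rw [Real.rpow_sub_one hr.ne', Real.rpow_sub_one hrR.ne', Real.rpow_sub_one hq.ne' (b - 1)]
  generalize (1 - (r / R) ^ c) ^ (b - 1) = Q
  generalize (r / R) ^ c = s at *
  have := hq.ne'
  field_simp
  ring

theorem fderiv_hardyDensity_apply_self {E : Type*} [NormedAddCommGroup E] [NormedSpace ℝ E]
    {f : E → ℝ} {x : E} {p R a b c : ℝ} (hp : 1 < p) (hf : DifferentiableAt ℝ f x)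
    (hx : 0 < ‖x‖) (hR : 0 < R) (hq : 0 < 1 - (‖x‖ / R) ^ c)
    (hD : DifferentiableAt ℝ
      (fun y ↦ |f y| ^ p / (‖y‖ ^ a * (1 - (‖y‖ / R) ^ c) ^ (b - 1))) x) :
    fderiv ℝ (fun y ↦ |f y| ^ p / (‖y‖ ^ a * (1 - (‖y‖ / R) ^ c) ^ (b - 1))) x x =
      (p * (|f x| ^ (p - 2) * f x) * fderiv ℝ f x x -
        |f x| ^ p * (a + (b - 1) * c - (b - 1) * c / (1 - (‖x‖ / R) ^ c))) /
        (‖x‖ ^ a * (1 - (‖x‖ / R) ^ c) ^ (b - 1)) := by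
  have hray : HasDerivAt (fun t : ℝ ↦ t • x) x 1 := by
    simpa using (hasDerivAt_id (1 : ℝ)).smul_const x
  have hcomp {g : E → ℝ} (hg : DifferentiableAt ℝ g x) :
      HasDerivAt (fun t : ℝ ↦ g (t • x)) (fderiv ℝ g x x) 1 :=
    HasFDerivAt.comp_hasDerivAt (f := fun t : ℝ ↦ t • x) 1
      (by simpa using hg.hasFDerivAt) hray
  have hnum := HasDerivAt.comp (h := fun t : ℝ ↦ f (t • x)) 1
    (hasDerivAt_abs_rpow (f ((1 : ℝ) • x)) hp) (hcomp hf)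
  have hW : ‖x‖ ^ a * (1 - (‖x‖ / R) ^ c) ^ (b - 1) ≠ 0 := by positivity
  have hquot := hnum.div (hasDerivAt_hardyWeight (a := a) (b := b) hx hR hq)
    (by simpa using hW)
  have hev : (fun t : ℝ ↦ |f (t • x)| ^ p /
      (‖t • x‖ ^ a * (1 - (‖t • x‖ / R) ^ c) ^ (b - 1))) =ᶠ[nhds 1]
      (((fun y : ℝ ↦ |y| ^ p) ∘ fun t : ℝ ↦ f (t • x)) /
        fun t : ℝ ↦ (t * ‖x‖) ^ a * (1 - (t * ‖x‖ / R) ^ c) ^ (b - 1)) := by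
    filter_upwards [lt_mem_nhds (zero_lt_one (α := ℝ))] with t ht
    simp [norm_smul, abs_of_pos ht]
  rw [(hcomp hD).unique (hquot.congr_of_eventuallyEq hev)]
  simp only [Function.comp_apply, one_smul, one_mul]
  field_simp

theorem hardy_pointwise {p K r q F g u a b β P I D' : ℝ} (hK : 0 < K)
    (hr : 0 < r) (hq : 0 < q) (hu : u = K⁻¹ * r * q * -g)
    (hI : p * I = |u| ^ p + (p - 1) * |F| ^ p - p * P * u)
    (hD : D' = (p * P * (r * g) - |F| ^ p * (a + β - β / q)) / (r ^ a * q ^ (b - 1))) :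
    p * K ^ p * (I / (r ^ a * q ^ b)) =
      |g| ^ p / (r ^ (a - p) * q ^ (b - p)) + (p - 1) * K ^ p * (|F| ^ p / (r ^ a * q ^ b)) +
        K ^ (p - 1) * (D' + (a + β) * (|F| ^ p / (r ^ a * q ^ (b - 1))) -
          β * (|F| ^ p / (r ^ a * q ^ b))) := by
  have hra : 0 < r ^ a := Real.rpow_pos_of_pos hr a
  have hqb : 0 < q ^ b := Real.rpow_pos_of_pos hq b
  have hKp : 0 < K ^ p := Real.rpow_pos_of_pos hK p
  have hup : |u| ^ p = (K ^ p)⁻¹ * r ^ p * q ^ p * |g| ^ p := by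
    rw [hu, abs_mul, abs_neg, abs_of_pos (by positivity : 0 < K⁻¹ * r * q),
      Real.mul_rpow (by positivity) (abs_nonneg _), Real.mul_rpow (by positivity) hq.le,
      Real.mul_rpow (by positivity) hr.le, Real.inv_rpow hK.le]
  have hrp : 0 < r ^ p := Real.rpow_pos_of_pos hr p
  have hqp : 0 < q ^ p := Real.rpow_pos_of_pos hq p
  have e : p * K ^ p * (I / (r ^ a * q ^ b)) = K ^ p * (p * I) / (r ^ a * q ^ b) := by ring
  rw [e, hI, hD, hup, hu, Real.rpow_sub hr, Real.rpow_sub hq, Real.rpow_sub_one hq.ne',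
    Real.rpow_sub_one hK.ne']
  field_simp
  ring

section HardyWeights

variable {n : ℕ} {R a b c p : ℝ} {f : EuclideanSpace ℝ (Fin n) → ℝ}
  {x : EuclideanSpace ℝ (Fin n)}

theorem norm_pos_of_mem_tsupport
    (hsupp : tsupport f ⊆ ball (0 : EuclideanSpace ℝ (Fin n)) R \ {0}) (hx : x ∈ tsupport f) :
    0 < ‖x‖ :=
  norm_pos_iff.2 fun h ↦ (hsupp hx).2 (by simpa using h)

theorem one_sub_rpow_pos_of_mem_tsupport (hR : 0 < R) (hc : 0 < c)
    (hsupp : tsupport f ⊆ ball (0 : EuclideanSpace ℝ (Fin n)) R \ {0}) (hx : x ∈ tsupport f) :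
    0 < 1 - (‖x‖ / R) ^ c := by
  have h : ‖x‖ < R := by simpa using (hsupp hx).1
  have := Real.rpow_lt_one (by positivity) ((div_lt_one hR).2 h) hc
  linarith

theorem contDiffAt_hardyWeight (hx : x ≠ 0) (hR : 0 < R) (hq : 0 < 1 - (‖x‖ / R) ^ c) :
    ContDiffAt ℝ 1 (fun y : EuclideanSpace ℝ (Fin n) ↦
      ‖y‖ ^ a * (1 - (‖y‖ / R) ^ c) ^ b) x := by
  have hn : ContDiffAt ℝ 1 (fun y : EuclideanSpace ℝ (Fin n) ↦ ‖y‖) x := contDiffAt_norm ℝ hx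
  have hx' : ‖x‖ ≠ 0 := norm_ne_zero_iff.2 hx
  exact (hn.rpow_const_of_ne hx').mul ((contDiffAt_const.sub
    ((hn.div_const R).rpow_const_of_ne (div_ne_zero hx' hR.ne'))).rpow_const_of_ne hq.ne')

theorem continuousAt_radDerivR (hf : ContDiff ℝ 1 f) (hx : x ≠ 0) :
    ContinuousAt (radDerivR f) x := by
  have hfd : Continuous (fderiv ℝ f) := hf.continuous_fderiv one_ne_zero
  exact hfd.continuousAt.clm_apply
    ((continuous_norm.continuousAt.inv₀ (norm_ne_zero_iff.2 hx)).smul continuousAt_id)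

theorem radDerivR_eq_zero_of_notMem_tsupport (hx : x ∉ tsupport f) : radDerivR f x = 0 := by
  simp [radDerivR, fderiv_of_notMem_tsupport ℝ hx]

theorem contDiff_hardyDensity (hp : 1 < p) (hR : 0 < R) (hc : 0 < c) (hf : ContDiff ℝ 1 f)
    (hsupp : tsupport f ⊆ ball (0 : EuclideanSpace ℝ (Fin n)) R \ {0}) :
    ContDiff ℝ 1 fun y ↦ |f y| ^ p / (‖y‖ ^ a * (1 - (‖y‖ / R) ^ c) ^ b) := by
  rw [contDiff_iff_contDiffAt]
  intro x
  by_cases hx : x ∈ tsupport f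
  · have hx0 := norm_pos_of_mem_tsupport hsupp hx
    have hq := one_sub_rpow_pos_of_mem_tsupport hR hc hsupp hx
    exact (hf.norm_rpow hp).contDiffAt.div
      (contDiffAt_hardyWeight (norm_pos_iff.1 hx0) hR hq) (by positivity)
  · refine (contDiffAt_const (c := (0 : ℝ))).congr_of_eventuallyEq ?_
    filter_upwards [notMem_tsupport_iff_eventuallyEq.1 hx] with y hy
    simp [hy, Real.zero_rpow (by linarith : p ≠ 0)]

theorem hasCompactSupport_hardyDensity (hp : 1 < p) (hcomp : HasCompactSupport f) :
    HasCompactSupport fun y ↦ |f y| ^ p / (‖y‖ ^ a * (1 - (‖y‖ / R) ^ c) ^ b) :=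
  hcomp.mono fun y hy hfy ↦ hy (by simp [hfy, Real.zero_rpow (by linarith : p ≠ 0)])

theorem integrable_radDerivR_rpow_div (hp : 1 < p) (hR : 0 < R) (hc : 0 < c)
    (hf : ContDiff ℝ 1 f) (hcomp : HasCompactSupport f)
    (hsupp : tsupport f ⊆ ball (0 : EuclideanSpace ℝ (Fin n)) R \ {0}) :
    Integrable fun y ↦ |radDerivR f y| ^ p / (‖y‖ ^ a * (1 - (‖y‖ / R) ^ c) ^ b) := by
  refine integrable_of_continuousAt_of_isCompact hcomp (fun x hx ↦ ?_) fun x hx ↦ by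
    simp [radDerivR_eq_zero_of_notMem_tsupport hx, Real.zero_rpow (by linarith : p ≠ 0)]
  have hx0 := norm_pos_of_mem_tsupport hsupp hx
  have hq := one_sub_rpow_pos_of_mem_tsupport hR hc hsupp hx
  have hx' : x ≠ 0 := norm_pos_iff.1 hx0
  exact ((continuousAt_radDerivR hf hx').abs.rpow_const (Or.inr (by linarith))).div
    (contDiffAt_hardyWeight hx' hR hq).continuousAt (by positivity)

end HardyWeights

theorem integral_hardy_combination {α : Type*} [MeasurableSpace α] {μ : Measure α}
    {B A E D : α → ℝ} (hB : Integrable B μ) (hA : Integrable A μ) (hE : Integrable E μ)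
    (hD : Integrable D μ) (k l m q : ℝ) :
    ∫ x, B x + k * A x + l * (E x + m * D x - q * A x) ∂μ =
      (∫ x, B x ∂μ) + k * (∫ x, A x ∂μ) +
        l * ((∫ x, E x ∂μ) + m * (∫ x, D x ∂μ) - q * ∫ x, A x ∂μ) := by
  have h1 : Integrable (fun x ↦ B x + k * A x) μ := hB.add (hA.const_mul k)
  have h2 : Integrable (fun x ↦ E x + m * D x) μ := hE.add (hD.const_mul m)
  have h3 : Integrable (fun x ↦ E x + m * D x - q * A x) μ := h2.sub (hA.const_mul q)
  rw [integral_add h1 (h3.const_mul l), integral_add hB (hA.const_mul k), integral_const_mul,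
    integral_const_mul, integral_sub h2 (hA.const_mul q), integral_add hE (hD.const_mul m),
    integral_const_mul, integral_const_mul]

theorem unified_hardy_Lp_identity {n : ℕ} (hn : 1 ≤ n) {R : ℝ} (hR : 0 < R)
    {p b a c : ℝ} (hp : 1 < p) (hb : 1 < b) (ha : a < (n : ℝ))
    (hc0 : 0 < c) (hc : c ≤ ((n : ℝ) - a) / (b - 1))
    (f : EuclideanSpace ℝ (Fin n) → ℝ)
    (hf : ContDiff ℝ 1 f) (hcomp : HasCompactSupport f)
    (hsupp : tsupport f ⊆ ball (0 : EuclideanSpace ℝ (Fin n)) R \ {0})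
    (u : EuclideanSpace ℝ (Fin n) → ℝ)
    (hu : ∀ x, u x = p / ((b - 1) * c) * ‖x‖ * (1 - (‖x‖ / R) ^ c) * (-(radDerivR f x))) :
    ((b - 1) * c / p) ^ p *
      (∫ x in ball (0 : EuclideanSpace ℝ (Fin n)) R,
        |f x| ^ p / (‖x‖ ^ a * (1 - (‖x‖ / R) ^ c) ^ b)) =
    (∫ x in ball (0 : EuclideanSpace ℝ (Fin n)) R,
        |radDerivR f x| ^ p / (‖x‖ ^ (a - p) * (1 - (‖x‖ / R) ^ c) ^ (b - p))) -
    p * ((b - 1) * c / p) ^ p *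
      (∫ x in ball (0 : EuclideanSpace ℝ (Fin n)) R,
        Ip p (f x) (u x) * |f x - u x| ^ 2 / (‖x‖ ^ a * (1 - (‖x‖ / R) ^ c) ^ b)) -
    ((n : ℝ) - a - (b - 1) * c) * ((b - 1) * c / p) ^ (p - 1) *
      (∫ x in ball (0 : EuclideanSpace ℝ (Fin n)) R,
        |f x| ^ p / (‖x‖ ^ a * (1 - (‖x‖ / R) ^ c) ^ (b - 1))) := by
  have hβ : 0 < (b - 1) * c := mul_pos (by linarith) hc0
  have hp0 : p ≠ 0 := by linarith
  set K : ℝ := (b - 1) * c / p with hKdef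
  have hK : 0 < K := div_pos hβ (by linarith)
  have hβK : (b - 1) * c = p * K := by rw [hKdef]; field_simp
  have hf0 {x : EuclideanSpace ℝ (Fin n)} (hx : x ∉ tsupport f) : f x = 0 :=
    image_eq_zero_of_notMem_tsupport hx
  have hu0 {x : EuclideanSpace ℝ (Fin n)} (hx : x ∉ tsupport f) : u x = 0 := by
    simp [hu, radDerivR_eq_zero_of_notMem_tsupport hx]
  have hout {x : EuclideanSpace ℝ (Fin n)} (hx : x ∉ ball 0 R) : x ∉ tsupport f :=
    fun h ↦ hx (hsupp h).1
  rw [setIntegral_eq_integral_of_forall_compl_eq_zero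
      fun x hx ↦ by simp [hf0 (hout hx), Real.zero_rpow hp0],
    setIntegral_eq_integral_of_forall_compl_eq_zero
      fun x hx ↦ by simp [radDerivR_eq_zero_of_notMem_tsupport (hout hx), Real.zero_rpow hp0],
    setIntegral_eq_integral_of_forall_compl_eq_zero
      fun x hx ↦ by simp [hf0 (hout hx), hu0 (hout hx)],
    setIntegral_eq_integral_of_forall_compl_eq_zero
      fun x hx ↦ by simp [hf0 (hout hx), Real.zero_rpow hp0]]
  have hDc (b' : ℝ) := contDiff_hardyDensity (a := a) (b := b') hp hR hc0 hf hsupp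
  have hDs (b' : ℝ) :=
    hasCompactSupport_hardyDensity (R := R) (a := a) (b := b') (c := c) hp hcomp
  have hDi (b' : ℝ) := (hDc b').continuous.integrable_of_hasCompactSupport (hDs b')
    (μ := (volume : Measure (EuclideanSpace ℝ (Fin n))))
  have hBi := integrable_radDerivR_rpow_div (a := a - p) (b := b - p) hp hR hc0 hf hcomp hsupp
  have hEuler := integral_fderiv_apply_self (hDc (b - 1)) (hDs (b - 1))
  have hfd := (hDc (b - 1)).continuous_fderiv one_ne_zero
  have hEi : Integrable fun x ↦ fderiv ℝ
      (fun y ↦ |f y| ^ p / (‖y‖ ^ a * (1 - (‖y‖ / R) ^ c) ^ (b - 1))) x x := by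
    refine (hfd.clm_apply continuous_id).integrable_of_hasCompactSupport ?_
    exact ((hDs (b - 1)).fderiv ℝ).mono fun x hx h0 ↦ hx (by simp [h0])
  have hpt (x : EuclideanSpace ℝ (Fin n)) :
      p * K ^ p * (Ip p (f x) (u x) * |f x - u x| ^ 2 / (‖x‖ ^ a * (1 - (‖x‖ / R) ^ c) ^ b)) =
        |radDerivR f x| ^ p / (‖x‖ ^ (a - p) * (1 - (‖x‖ / R) ^ c) ^ (b - p)) +
        (p - 1) * K ^ p * (|f x| ^ p / (‖x‖ ^ a * (1 - (‖x‖ / R) ^ c) ^ b)) +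
        K ^ (p - 1) * (fderiv ℝ
            (fun y ↦ |f y| ^ p / (‖y‖ ^ a * (1 - (‖y‖ / R) ^ c) ^ (b - 1))) x x +
          (a + (b - 1) * c) * (|f x| ^ p / (‖x‖ ^ a * (1 - (‖x‖ / R) ^ c) ^ (b - 1))) -
          (b - 1) * c * (|f x| ^ p / (‖x‖ ^ a * (1 - (‖x‖ / R) ^ c) ^ b))) := by
    by_cases hx : x ∈ tsupport f
    · have hx0 := norm_pos_of_mem_tsupport hsupp hx
      have hq := one_sub_rpow_pos_of_mem_tsupport hR hc0 hsupp hx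
      refine hardy_pointwise hK hx0 hq ?_ (Ip_mul_abs_sub_sq hp (f x) (u x)) ?_
      · rw [hu, hKdef, inv_div]
      · rw [fderiv_hardyDensity_apply_self hp (hf.differentiable one_ne_zero x) hx0 hR hq
          ((hDc (b - 1)).differentiable one_ne_zero x), radDerivR, map_smul, smul_eq_mul,
          mul_inv_cancel_left₀ hx0.ne']
    · have hsub : tsupport (fun y ↦ |f y| ^ p / (‖y‖ ^ a * (1 - (‖y‖ / R) ^ c) ^ (b - 1))) ⊆
          tsupport f :=
        closure_mono fun y hy hfy ↦ hy (by simp [hfy, Real.zero_rpow hp0])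
      rw [fderiv_of_notMem_tsupport ℝ fun h ↦ hx (hsub h)]
      simp [hf0 hx, hu0 hx, radDerivR_eq_zero_of_notMem_tsupport hx, Real.zero_rpow hp0]
  have hint := integral_congr_ae (μ := volume) (Filter.Eventually.of_forall hpt)
  rw [integral_const_mul, integral_hardy_combination hBi (hDi b) hEi (hDi (b - 1)), hEuler] at hint
  rw [hint, Real.rpow_sub_one hK.ne', hβK]
  field_simp
  ring
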